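/- Quasi-flat normal form: every left-downward closed TeamLTL(∼,⊽)-formula φ is equivalent under lax team semantics (satisfied by exactly the same teams) to a quasi-flat formula, i.e. a formula of the form ⊽_{i∈I} (αᵢ ∧ ⋀_{j∈Jᵢ} ∃βᵢⱼ), where I and the Jᵢ are finite index sets and the αᵢ and βᵢⱼ are LTL-formulae. -/

import Mathlib

namespace TeamLTL

/-- A trace over atomic propositions `AP` is an infinite sequence of sets of propositions. -/
abbrev Trace (AP : Type) := ℕ → Set AP

/-- `t[i,∞]`, the suffix of a trace. -/
def Trace.suffix {AP : Type} (t : Trace AP) (i : ℕ) : Trace AP := fun j => t (i + j)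

/-- A team is a set of traces. -/
abbrev Team (AP : Type) := Set (Trace AP)

/-- `T[f,∞] = { t[s,∞] : t ∈ T, s ∈ f t }` for `f : T → P(ℕ)⁺`. -/
def Team.update {AP : Type} (T : Team AP) (f : Trace AP → Set ℕ) : Team AP :=
  { s | ∃ t ∈ T, ∃ i ∈ f t, s = Trace.suffix t i }

/-- `f` maps every trace of `T` to a nonempty set of naturals (i.e. `f : T → P(ℕ)⁺`). -/
def properOn {AP : Type} (T : Team AP) (f : Trace AP → Set ℕ) : Prop :=
  ∀ t ∈ T, (f t).Nonempty

/-- `f' < f` on the team `T'`: for all `t ∈ T'`, `min (f' t) ≤ min (f t)` and whenever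
`f t` has a maximum, `f' t` has a maximum which is strictly smaller. -/
def funLT {AP : Type} (T' : Team AP) (f' f : Trace AP → Set ℕ) : Prop :=
  ∀ t ∈ T', sInf (f' t) ≤ sInf (f t) ∧
    ∀ m, IsGreatest (f t) m → ∃ m', IsGreatest (f' t) m' ∧ m' < m

/-- Formulae of TeamLTL, together with the Boolean disjunction `bor` (⊽) and the
Boolean negation `bneg` (∼).  Plain TeamLTL-formulae (= LTL-formulae in negation
normal form) are those satisfying `isLTL` below. -/
inductive Formula (AP : Type) : Type
  | atom  : AP → Formula AP
  | natom : AP → Formula AP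
  | conj  : Formula AP → Formula AP → Formula AP
  | disj  : Formula AP → Formula AP → Formula AP
  | next  : Formula AP → Formula AP
  | glob  : Formula AP → Formula AP
  | untl  : Formula AP → Formula AP → Formula AP
  | bor   : Formula AP → Formula AP → Formula AP
  | bneg  : Formula AP → Formula AP

/-- Lax team semantics `T ⊨ˡ φ`. -/
def laxSat {AP : Type} : Formula AP → Team AP → Prop
  | .atom p, T => ∀ t ∈ T, p ∈ t 0
  | .natom p, T => ∀ t ∈ T, p ∉ t 0
  | .conj φ ψ, T => laxSat φ T ∧ laxSat ψ T
  | .disj φ ψ, T => ∃ T₁ T₂ : Team AP, T = T₁ ∪ T₂ ∧ laxSat φ T₁ ∧ laxSat ψ T₂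
  | .next φ, T => laxSat φ (Team.update T (fun _ => {1}))
  | .glob φ, T => ∀ f, properOn T f → laxSat φ (Team.update T f)
  | .untl φ ψ, T => ∃ f, properOn T f ∧ laxSat ψ (Team.update T f) ∧
      ({t ∈ T | f t ≠ ({0} : Set ℕ)} = ∅ ∨
        ∀ f', properOn {t ∈ T | f t ≠ ({0} : Set ℕ)} f' →
          funLT {t ∈ T | f t ≠ ({0} : Set ℕ)} f' f →
          laxSat φ (Team.update {t ∈ T | f t ≠ ({0} : Set ℕ)} f'))
  | .bor φ ψ, T => laxSat φ T ∨ laxSat ψ T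
  | .bneg φ, T => ¬ laxSat φ T

/-- Classical LTL semantics on a single trace. -/
def traceSat {AP : Type} : Formula AP → Trace AP → Prop
  | .atom p, t => p ∈ t 0
  | .natom p, t => p ∉ t 0
  | .conj φ ψ, t => traceSat φ t ∧ traceSat ψ t
  | .disj φ ψ, t => traceSat φ t ∨ traceSat ψ t
  | .next φ, t => traceSat φ (Trace.suffix t 1)
  | .glob φ, t => ∀ i, traceSat φ (Trace.suffix t i)
  | .untl φ ψ, t => ∃ i, traceSat ψ (Trace.suffix t i) ∧ ∀ j < i, traceSat φ (Trace.suffix t j)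
  | .bor φ ψ, t => traceSat φ t ∨ traceSat ψ t
  | .bneg φ, t => ¬ traceSat φ t

/-- `φ` is a plain LTL-formula (no ⊽ and no ∼). -/
def Formula.isLTL {AP : Type} : Formula AP → Prop
  | .atom _ => True
  | .natom _ => True
  | .conj φ ψ => φ.isLTL ∧ ψ.isLTL
  | .disj φ ψ => φ.isLTL ∧ ψ.isLTL
  | .next φ => φ.isLTL
  | .glob φ => φ.isLTL
  | .untl φ ψ => φ.isLTL ∧ ψ.isLTL
  | .bor _ _ => False
  | .bneg _ => False

/-- `φ` is a TeamLTL(⊽)-formula (no Boolean negation ∼). -/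
def Formula.noBneg {AP : Type} : Formula AP → Prop
  | .atom _ => True
  | .natom _ => True
  | .conj φ ψ => φ.noBneg ∧ ψ.noBneg
  | .disj φ ψ => φ.noBneg ∧ ψ.noBneg
  | .next φ => φ.noBneg
  | .glob φ => φ.noBneg
  | .untl φ ψ => φ.noBneg ∧ ψ.noBneg
  | .bor φ ψ => φ.noBneg ∧ ψ.noBneg
  | .bneg _ => False

/-- `φ` is a TeamLTL(∼)-formula (no Boolean disjunction ⊽). -/
def Formula.noBor {AP : Type} : Formula AP → Prop
  | .atom _ => True
  | .natom _ => True
  | .conj φ ψ => φ.noBor ∧ ψ.noBor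
  | .disj φ ψ => φ.noBor ∧ ψ.noBor
  | .next φ => φ.noBor
  | .glob φ => φ.noBor
  | .untl φ ψ => φ.noBor ∧ ψ.noBor
  | .bor _ _ => False
  | .bneg φ => φ.noBor

/-- Left-flatness: in every subformula `G ψ` and `ψ U θ`, `ψ` is an LTL-formula;
moreover `φ` is a TeamLTL(⊽)-formula (no ∼). -/
def Formula.leftFlat {AP : Type} : Formula AP → Prop
  | .atom _ => True
  | .natom _ => True
  | .conj φ ψ => φ.leftFlat ∧ ψ.leftFlat
  | .disj φ ψ => φ.leftFlat ∧ ψ.leftFlat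
  | .next φ => φ.leftFlat
  | .glob φ => φ.isLTL
  | .untl φ ψ => φ.isLTL ∧ ψ.leftFlat
  | .bor φ ψ => φ.leftFlat ∧ ψ.leftFlat
  | .bneg _ => False

/-- Left-downward closure: in every subformula `G ψ` and `ψ U θ`, `ψ` is a
TeamLTL(⊽)-formula (contains no ∼). -/
def Formula.leftDC {AP : Type} : Formula AP → Prop
  | .atom _ => True
  | .natom _ => True
  | .conj φ ψ => φ.leftDC ∧ ψ.leftDC
  | .disj φ ψ => φ.leftDC ∧ ψ.leftDC
  | .next φ => φ.leftDC
  | .glob φ => φ.noBneg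
  | .untl φ ψ => φ.noBneg ∧ ψ.leftDC
  | .bor φ ψ => φ.leftDC ∧ ψ.leftDC
  | .bneg φ => φ.leftDC

/-- Length (size) of a formula. -/
def Formula.size {AP : Type} : Formula AP → ℕ
  | .atom _ => 1
  | .natom _ => 1
  | .conj φ ψ => φ.size + ψ.size + 1
  | .disj φ ψ => φ.size + ψ.size + 1
  | .next φ => φ.size + 1
  | .glob φ => φ.size + 1
  | .untl φ ψ => φ.size + ψ.size + 1
  | .bor φ ψ => φ.size + ψ.size + 1
  | .bneg φ => φ.size + 1

/-- Number of occurrences of the Boolean disjunction ⊽ in a formula. -/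
def Formula.borCount {AP : Type} : Formula AP → ℕ
  | .atom _ => 0
  | .natom _ => 0
  | .conj φ ψ => φ.borCount + ψ.borCount
  | .disj φ ψ => φ.borCount + ψ.borCount
  | .next φ => φ.borCount
  | .glob φ => φ.borCount
  | .untl φ ψ => φ.borCount + ψ.borCount
  | .bor φ ψ => φ.borCount + ψ.borCount + 1
  | .bneg φ => φ.borCount

/-- Boolean disjunction `⊽` of a nonempty list of formulae (head plus tail). -/
def disjOf {AP : Type} : Formula AP → List (Formula AP) → Formula AP
  | a, [] => a
  | a, b :: l => .bor a (disjOf b l)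

/-- Conjunction `a ∧ ⋀ l` of a formula with a (possibly empty) list of formulae. -/
def conjAnd {AP : Type} (a : Formula AP) : List (Formula AP) → Formula AP
  | [] => a
  | b :: l => .conj (conjAnd a l) b

/-- Some atomic proposition occurring in a formula. -/
def Formula.someAtom {AP : Type} : Formula AP → AP
  | .atom p => p
  | .natom p => p
  | .conj φ _ => φ.someAtom
  | .disj φ _ => φ.someAtom
  | .next φ => φ.someAtom
  | .glob φ => φ.someAtom
  | .untl φ _ => φ.someAtom
  | .bor φ _ => φ.someAtom
  | .bneg φ => φ.someAtom

/-- The dual `φ^d`: the negation normal form of `¬φ` (for LTL-formulae `φ`).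
`¬Gφ` is rewritten as `⊤ U ¬φ` and `¬(φUψ)` as `(¬ψ U (¬φ ∧ ¬ψ)) ∨ G¬ψ`. -/
def Formula.dual {AP : Type} : Formula AP → Formula AP
  | .atom p => .natom p
  | .natom p => .atom p
  | .conj φ ψ => .disj φ.dual ψ.dual
  | .disj φ ψ => .conj φ.dual ψ.dual
  | .next φ => .next φ.dual
  | .glob φ => .untl (.disj (.atom φ.someAtom) (.natom φ.someAtom)) φ.dual
  | .untl φ ψ => .disj (.untl ψ.dual (.conj φ.dual ψ.dual)) (.glob ψ.dual)
  | .bor φ ψ => .conj φ.dual ψ.dual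
  | .bneg φ => φ

/-- `∃β`, an abbreviation for `∼β^d`: it holds in a team `T` iff some trace of `T`
satisfies `β` classically. -/
def Formula.exi {AP : Type} (β : Formula AP) : Formula AP := .bneg β.dual

end TeamLTL

namespace TeamLTL

variable {AP : Type}

theorem forall_mem_update {T : Team AP} {f : Trace AP → Set ℕ} {P : Trace AP → Prop} :
    (∀ s ∈ T.update f, P s) ↔ ∀ t ∈ T, ∀ i ∈ f t, P (t.suffix i) :=
  ⟨fun h t ht i hi => h _ ⟨t, ht, i, hi, rfl⟩, by
    rintro h _ ⟨t, ht, i, hi, rfl⟩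
    exact h t ht i hi⟩

theorem exists_mem_update {T : Team AP} {f : Trace AP → Set ℕ} {P : Trace AP → Prop} :
    (∃ s ∈ T.update f, P s) ↔ ∃ t ∈ T, ∃ i ∈ f t, P (t.suffix i) :=
  ⟨by
    rintro ⟨_, ⟨t, ht, i, hi, rfl⟩, h⟩
    exact ⟨t, ht, i, hi, h⟩, fun ⟨t, ht, i, hi, h⟩ => ⟨_, ⟨t, ht, i, hi, rfl⟩, h⟩⟩

theorem update_empty (f : Trace AP → Set ℕ) : Team.update (∅ : Team AP) f = ∅ := by
  simp [Team.update]

theorem laxSat_empty {φ : Formula AP} (h : φ.noBneg) : laxSat φ ∅ := by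
  induction φ with
  | atom p => simp [laxSat]
  | natom p => simp [laxSat]
  | conj φ ψ ih₁ ih₂ => exact ⟨ih₁ h.1, ih₂ h.2⟩
  | disj φ ψ ih₁ ih₂ => exact ⟨∅, ∅, by simp, ih₁ h.1, ih₂ h.2⟩
  | next φ ih => simpa [laxSat, update_empty] using ih h
  | glob φ ih => simpa [laxSat, update_empty] using fun _ _ => ih h
  | untl φ ψ ih₁ ih₂ =>
    exact ⟨fun _ => {0}, by simp [properOn], by simpa [update_empty] using ih₂ h.2, by simp⟩
  | bor φ ψ ih₁ ih₂ => exact Or.inl (ih₁ h.1)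
  | bneg φ ih => exact h.elim

theorem Formula.isLTL.noBneg {φ : Formula AP} (h : φ.isLTL) : φ.noBneg := by
  induction φ with
  | atom p => trivial
  | natom p => trivial
  | conj φ ψ ih₁ ih₂ => exact ⟨ih₁ h.1, ih₂ h.2⟩
  | disj φ ψ ih₁ ih₂ => exact ⟨ih₁ h.1, ih₂ h.2⟩
  | next φ ih => exact ih h
  | glob φ ih => exact ih h
  | untl φ ψ ih₁ ih₂ => exact ⟨ih₁ h.1, ih₂ h.2⟩
  | bor φ ψ ih₁ ih₂ => exact h.elim
  | bneg φ ih => exact h.elim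

theorem Formula.isLTL.dual {φ : Formula AP} (h : φ.isLTL) : φ.dual.isLTL := by
  induction φ with
  | atom p => trivial
  | natom p => trivial
  | conj φ ψ ih₁ ih₂ => exact ⟨ih₁ h.1, ih₂ h.2⟩
  | disj φ ψ ih₁ ih₂ => exact ⟨ih₁ h.1, ih₂ h.2⟩
  | next φ ih => exact ih h
  | glob φ ih => exact ⟨⟨trivial, trivial⟩, ih h⟩
  | untl φ ψ ih₁ ih₂ => exact ⟨⟨ih₂ h.2, ih₁ h.1, ih₂ h.2⟩, ih₂ h.2⟩
  | bor φ ψ ih₁ ih₂ => exact h.elim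
  | bneg φ ih => exact h.elim

theorem traceSat_dual {φ : Formula AP} (h : φ.isLTL) (t : Trace AP) :
    traceSat φ.dual t ↔ ¬ traceSat φ t := by
  induction φ generalizing t with
  | atom p => rfl
  | natom p => simp [Formula.dual, traceSat]
  | conj φ ψ ih₁ ih₂ => simp [Formula.dual, traceSat, ih₁ h.1, ih₂ h.2, imp_iff_not_or]
  | disj φ ψ ih₁ ih₂ => simp [Formula.dual, traceSat, ih₁ h.1, ih₂ h.2]
  | next φ ih => simp [Formula.dual, traceSat, ih h]
  | glob φ ih => simp [Formula.dual, traceSat, ih h, em]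
  | untl φ ψ ih₁ ih₂ =>
    simp only [Formula.dual, traceSat, ih₁ h.1, ih₂ h.2]
    constructor
    · rintro (⟨i, ⟨hφ, hψ⟩, hlt⟩ | hG) ⟨k, hk, hkφ⟩
      · rcases lt_trichotomy k i with hki | rfl | hik
        · exact hlt k hki hk
        · exact hψ hk
        · exact hφ (hkφ i hik)
      · exact hG k hk
    · intro hn
      by_cases hG : ∀ i, ¬ traceSat ψ (t.suffix i)
      · exact Or.inr hG
      left
      push Not at hG hn
      classical
      have hk := Nat.find_spec hG
      have hmin := fun j => Nat.find_min hG (m := j)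
      obtain ⟨j, hj, hjφ⟩ := hn _ hk
      exact ⟨j, ⟨hjφ, hmin j hj⟩, fun l hl => hmin l (hl.trans hj)⟩
  | bor φ ψ ih₁ ih₂ => exact h.elim
  | bneg φ ih => exact h.elim

/-- If the left argument of an until is a Boolean disjunction of flat formulae, then the largest
admissible `f' < f` decides the left-hand condition. -/
theorem laxSat_untl_iff {φ ψ : Formula AP} {L : List (Formula AP)}
    (hL : ∀ T, laxSat φ T ↔ ∃ α ∈ L, ∀ t ∈ T, traceSat α t) (h₀ : laxSat φ ∅) (T : Team AP) :
    laxSat (.untl φ ψ) T ↔ ∃ α ∈ L, ∃ f, properOn T f ∧ laxSat ψ (T.update f) ∧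
      ∀ t ∈ T, ∀ i ∈ f t, ∀ j < i, traceSat α (t.suffix j) := by
  constructor
  · rintro ⟨f, hf, hψ, h⟩
    rcases h with h | h
    · obtain ⟨α, hα, -⟩ := (hL ∅).1 h₀
      refine ⟨α, hα, f, hf, hψ, fun t ht i hi j hj => ?_⟩
      have h0 : f t = {0} := by
        by_contra hne
        exact (Set.eq_empty_iff_forall_notMem.1 h t) ⟨ht, hne⟩
      rw [h0, Set.mem_singleton_iff] at hi
      omega
    · have hpos : ∀ t ∈ {t ∈ T | f t ≠ ({0} : Set ℕ)}, ∃ k ∈ f t, 0 < k := by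
        rintro t ⟨ht, hne⟩
        by_contra! hk
        exact hne (Set.eq_singleton_iff_nonempty_unique_mem.2
          ⟨hf t ht, fun k hk' => Nat.le_zero.1 (hk k hk')⟩)
      have hF := h (fun t => {j | ∃ k ∈ f t, j < k}) (fun t ht => ⟨0, hpos t ht⟩) (by
        intro t ht
        refine ⟨(Nat.sInf_le (hpos t ht)).trans (Nat.zero_le _), fun m hm => ?_⟩
        obtain ⟨k, hk, hk0⟩ := hpos t ht
        have hkm := hm.2 hk
        refine ⟨m - 1, ⟨⟨m, hm.1, by omega⟩, ?_⟩, by omega⟩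
        rintro j ⟨l, hl, hjl⟩
        have := hm.2 hl
        omega)
      obtain ⟨α, hα, hall⟩ := (hL _).1 hF
      rw [forall_mem_update] at hall
      refine ⟨α, hα, f, hf, hψ, fun t ht i hi j hj => hall t ⟨ht, fun h0 => ?_⟩ j ⟨i, hi, hj⟩⟩
      rw [h0, Set.mem_singleton_iff] at hi
      omega
  · rintro ⟨α, hα, f, hf, hψ, h⟩
    refine ⟨f, hf, hψ, Or.inr fun f' hf' hlt => (hL _).2 ⟨α, hα, forall_mem_update.2 ?_⟩⟩
    rintro t ht j hj
    obtain ⟨i, hi, hji⟩ : ∃ i ∈ f t, j < i := by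
      by_contra! hle
      have hb : BddAbove (f t) := ⟨j, hle⟩
      obtain ⟨m', hm', hm'lt⟩ := (hlt t ht).2 (sSup (f t))
        ⟨Nat.sSup_mem (hf t ht.1) hb, fun _ hk => le_csSup hb hk⟩
      have h₁ := hm'.2 hj
      have h₂ := hle _ (Nat.sSup_mem (hf t ht.1) hb)
      omega
    exact h t ht.1 i hi j hji

/-- `T` satisfies the quasi-flat conjunction `α ∧ ⋀ ∃β`, where `y = (α, [β, …])`. -/
def clauseSat (y : Formula AP × List (Formula AP)) (T : Team AP) : Prop :=
  (∀ t ∈ T, traceSat y.1 t) ∧ ∀ β ∈ y.2, ∃ t ∈ T, traceSat β t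

/-- The components of a quasi-flat conjunction are LTL-formulae. -/
def clauseLTL (y : Formula AP × List (Formula AP)) : Prop :=
  y.1.isLTL ∧ ∀ β ∈ y.2, β.isLTL

/-- Evaluation of `α U (β ∧ ⋀ ∃γ)` for flat `α`, `β`, `γ`. -/
theorem untl_clause_iff (α : Formula AP) (y : Formula AP × List (Formula AP)) (T : Team AP) :
    (∃ f, properOn T f ∧ clauseSat y (T.update f) ∧
      ∀ t ∈ T, ∀ i ∈ f t, ∀ j < i, traceSat α (t.suffix j)) ↔
    clauseSat (.untl α y.1, y.2.map fun γ => .untl α (.conj y.1 γ)) T := by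
  simp only [clauseSat, forall_mem_update, exists_mem_update, List.forall_mem_map, traceSat]
  constructor
  · rintro ⟨f, hf, ⟨hβ, hγ⟩, hα⟩
    refine ⟨fun t ht => ?_, fun γ hγy => ?_⟩
    · obtain ⟨i, hi⟩ := hf t ht
      exact ⟨i, hβ t ht i hi, hα t ht i hi⟩
    · obtain ⟨t, ht, i, hi, h⟩ := hγ γ hγy
      exact ⟨t, ht, i, ⟨hβ t ht i hi, h⟩, hα t ht i hi⟩
  · rintro ⟨h₁, h₂⟩
    refine ⟨fun t => {i | traceSat y.1 (t.suffix i) ∧ ∀ j < i, traceSat α (t.suffix j)},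
      h₁, ⟨fun t _ i hi => hi.1, fun γ hγ => ?_⟩, fun t _ i hi => hi.2⟩
    obtain ⟨t, ht, i, ⟨hβ, h⟩, hα⟩ := h₂ γ hγ
    exact ⟨t, ht, i, ⟨hβ, hα⟩, h⟩

theorem disj_clause_iff (y z : Formula AP × List (Formula AP)) (T : Team AP) :
    (∃ T₁ T₂ : Team AP, T = T₁ ∪ T₂ ∧ clauseSat y T₁ ∧ clauseSat z T₂) ↔
    clauseSat (.disj y.1 z.1, y.2.map (.conj y.1) ++ z.2.map (.conj z.1)) T := by
  simp only [clauseSat, List.forall_mem_append, List.forall_mem_map, traceSat]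
  constructor
  · rintro ⟨T₁, T₂, rfl, ⟨h₁, h₁'⟩, h₂, h₂'⟩
    refine ⟨fun t ht => ht.imp (h₁ t) (h₂ t), fun β hβ => ?_, fun β hβ => ?_⟩
    · obtain ⟨t, ht, h⟩ := h₁' β hβ
      exact ⟨t, Or.inl ht, h₁ t ht, h⟩
    · obtain ⟨t, ht, h⟩ := h₂' β hβ
      exact ⟨t, Or.inr ht, h₂ t ht, h⟩
  · rintro ⟨h, h₁, h₂⟩
    refine ⟨{t ∈ T | traceSat y.1 t}, {t ∈ T | traceSat z.1 t}, ?_,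
      ⟨fun t ht => ht.2, fun β hβ => ?_⟩, fun t ht => ht.2, fun β hβ => ?_⟩
    · ext t
      exact ⟨fun ht => (h t ht).imp (⟨ht, ·⟩) (⟨ht, ·⟩), fun ht => ht.elim And.left And.left⟩
    · obtain ⟨t, ht, h₃, h₄⟩ := h₁ β hβ
      exact ⟨t, ⟨ht, h₃⟩, h₄⟩
    · obtain ⟨t, ht, h₃, h₄⟩ := h₂ β hβ
      exact ⟨t, ⟨ht, h₃⟩, h₄⟩

theorem disj_flat_iff (α β : Formula AP) (T : Team AP) :
    (∃ T₁ T₂ : Team AP, T = T₁ ∪ T₂ ∧ (∀ t ∈ T₁, traceSat α t) ∧ ∀ t ∈ T₂, traceSat β t) ↔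
    ∀ t ∈ T, traceSat (.disj α β) t := by
  simpa [clauseSat] using disj_clause_iff (α, []) (β, []) T

theorem untl_flat_iff (α β : Formula AP) (T : Team AP) :
    (∃ f, properOn T f ∧ (∀ t ∈ T.update f, traceSat β t) ∧
      ∀ t ∈ T, ∀ i ∈ f t, ∀ j < i, traceSat α (t.suffix j)) ↔
    ∀ t ∈ T, traceSat (.untl α β) t := by
  simpa [clauseSat] using untl_clause_iff α (β, []) T

theorem glob_flat_iff (L : List (Formula AP)) (T : Team AP) :
    (∀ f, properOn T f → ∃ α ∈ L, ∀ t ∈ T.update f, traceSat α t) ↔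
    ∃ α ∈ L, ∀ t ∈ T, traceSat (.glob α) t := by
  simp only [forall_mem_update, traceSat]
  constructor
  · intro h
    simpa using h (fun _ => Set.univ) fun _ _ => Set.univ_nonempty
  · rintro ⟨α, hα, h⟩ f -
    exact ⟨α, hα, fun t ht i _ => h t ht i⟩

theorem laxSat_iff_of_isLTL {φ : Formula AP} (h : φ.isLTL) (T : Team AP) :
    laxSat φ T ↔ ∀ t ∈ T, traceSat φ t := by
  induction φ generalizing T with
  | atom p => rfl
  | natom p => rfl
  | conj φ ψ ih₁ ih₂ => simp only [laxSat, traceSat, ih₁ h.1, ih₂ h.2, forall₂_and]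
  | disj φ ψ ih₁ ih₂ => simp only [laxSat, ih₁ h.1, ih₂ h.2, disj_flat_iff]
  | next φ ih => simp [laxSat, traceSat, ih h, forall_mem_update]
  | glob φ ih => simpa [laxSat, ih h] using glob_flat_iff [φ] T
  | untl φ ψ ih₁ ih₂ =>
    rw [laxSat_untl_iff (L := [φ]) (by simpa using ih₁ h.1) (laxSat_empty h.1.noBneg)]
    simp only [List.mem_singleton, exists_eq_left, ih₂ h.2, untl_flat_iff]
  | bor φ ψ ih₁ ih₂ => exact h.elim
  | bneg φ ih => exact h.elim

/-- `P` is the property of teams defined by a Boolean disjunction of LTL-formulae. -/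
def IsFlatDisj (P : Team AP → Prop) : Prop :=
  ∃ L : List (Formula AP), (∀ α ∈ L, α.isLTL) ∧ ∀ T, P T ↔ ∃ α ∈ L, ∀ t ∈ T, traceSat α t

theorem IsFlatDisj.of_map₂ {P : Team AP → Prop} {L M : List (Formula AP)}
    (g : Formula AP → Formula AP → Formula AP)
    (hg : ∀ α ∈ L, ∀ β ∈ M, (g α β).isLTL)
    (hP : ∀ T, P T ↔ ∃ α ∈ L, ∃ β ∈ M, ∀ t ∈ T, traceSat (g α β) t) : IsFlatDisj P := by
  refine ⟨L.flatMap fun α => M.map (g α), ?_, fun T => (hP T).trans ?_⟩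
  · simp only [List.mem_flatMap, List.mem_map]
    rintro _ ⟨α, hα, β, hβ, rfl⟩
    exact hg α hα β hβ
  · simp only [List.mem_flatMap, List.mem_map]
    constructor
    · rintro ⟨α, hα, β, hβ, h⟩
      exact ⟨_, ⟨α, hα, β, hβ, rfl⟩, h⟩
    · rintro ⟨_, ⟨α, hα, β, hβ, rfl⟩, h⟩
      exact ⟨α, hα, β, hβ, h⟩

theorem isFlatDisj_laxSat {φ : Formula AP} (h : φ.noBneg) : IsFlatDisj (laxSat φ) := by
  induction φ with
  | atom p => exact ⟨[.atom p], by simp [Formula.isLTL], by simp [laxSat, traceSat]⟩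
  | natom p => exact ⟨[.natom p], by simp [Formula.isLTL], by simp [laxSat, traceSat]⟩
  | conj φ ψ ih₁ ih₂ =>
    obtain ⟨L, hL, hLP⟩ := ih₁ h.1
    obtain ⟨M, hM, hMP⟩ := ih₂ h.2
    refine .of_map₂ .conj (fun α hα β hβ => ⟨hL α hα, hM β hβ⟩) fun T => ?_
    simp only [laxSat, traceSat, hLP, hMP, forall₂_and]
    grind
  | disj φ ψ ih₁ ih₂ =>
    obtain ⟨L, hL, hLP⟩ := ih₁ h.1
    obtain ⟨M, hM, hMP⟩ := ih₂ h.2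
    refine .of_map₂ .disj (fun α hα β hβ => ⟨hL α hα, hM β hβ⟩) fun T => ?_
    simp only [laxSat, hLP, hMP, ← disj_flat_iff]
    grind
  | next φ ih =>
    obtain ⟨L, hL, hLP⟩ := ih h
    refine ⟨L.map .next, List.forall_mem_map.2 hL, fun T => ?_⟩
    simp [laxSat, traceSat, hLP, forall_mem_update]
  | glob φ ih =>
    obtain ⟨L, hL, hLP⟩ := ih h
    refine ⟨L.map .glob, List.forall_mem_map.2 hL, fun T => ?_⟩
    simp only [laxSat, hLP, glob_flat_iff]
    simp
  | untl φ ψ ih₁ ih₂ =>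
    obtain ⟨L, hL, hLP⟩ := ih₁ h.1
    obtain ⟨M, hM, hMP⟩ := ih₂ h.2
    refine .of_map₂ .untl (fun α hα β hβ => ⟨hL α hα, hM β hβ⟩) fun T => ?_
    rw [laxSat_untl_iff hLP (laxSat_empty h.1)]
    simp only [hMP, ← untl_flat_iff]
    grind
  | bor φ ψ ih₁ ih₂ =>
    obtain ⟨L, hL, hLP⟩ := ih₁ h.1
    obtain ⟨M, hM, hMP⟩ := ih₂ h.2
    refine ⟨L ++ M, List.forall_mem_append.2 ⟨hL, hM⟩, fun T => ?_⟩
    simp only [laxSat, hLP, hMP, List.mem_append]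
    grind
  | bneg φ ih => exact h.elim

/-- `P` is the property of teams defined by a quasi-flat formula. -/
def IsQuasiFlat (P : Team AP → Prop) : Prop :=
  ∃ L : List (Formula AP × List (Formula AP)), (∀ y ∈ L, clauseLTL y) ∧
    ∀ T, P T ↔ ∃ y ∈ L, clauseSat y T

theorem isQuasiFlat_clauseSat {y : Formula AP × List (Formula AP)} (h : clauseLTL y) :
    IsQuasiFlat (clauseSat y) :=
  ⟨[y], by simpa using h, by simp⟩

theorem IsQuasiFlat.congr {P Q : Team AP → Prop} (hQ : IsQuasiFlat Q) (h : ∀ T, P T ↔ Q T) :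
    IsQuasiFlat P :=
  (funext fun T => propext (h T) : P = Q) ▸ hQ

theorem isQuasiFlat_flat {α : Formula AP} (h : α.isLTL) :
    IsQuasiFlat fun T => ∀ t ∈ T, traceSat α t :=
  (isQuasiFlat_clauseSat (y := (α, [])) ⟨h, by simp⟩).congr fun T => by simp [clauseSat]

theorem IsQuasiFlat.or {P Q : Team AP → Prop} (hP : IsQuasiFlat P) (hQ : IsQuasiFlat Q) :
    IsQuasiFlat fun T => P T ∨ Q T := by
  obtain ⟨L, hL, hLP⟩ := hP
  obtain ⟨M, hM, hMQ⟩ := hQ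
  refine ⟨L ++ M, List.forall_mem_append.2 ⟨hL, hM⟩, fun T => ?_⟩
  simp only [hLP, hMQ, List.mem_append]
  grind

theorem IsQuasiFlat.exists_mem {ι : Type*} {Q : ι → Team AP → Prop} {L : List ι}
    (h : ∀ y ∈ L, IsQuasiFlat (Q y)) : IsQuasiFlat fun T => ∃ y ∈ L, Q y T := by
  induction L with
  | nil => exact ⟨[], by simp, by simp⟩
  | cons y L ih =>
    obtain ⟨h₁, h₂⟩ := List.forall_mem_cons.1 h
    exact (h₁.or (ih h₂)).congr fun T => by simp

theorem IsQuasiFlat.and {P Q : Team AP → Prop} (hP : IsQuasiFlat P) (hQ : IsQuasiFlat Q) :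
    IsQuasiFlat fun T => P T ∧ Q T := by
  obtain ⟨L, hL, hLP⟩ := hP
  obtain ⟨M, hM, hMQ⟩ := hQ
  refine (exists_mem fun y hy => exists_mem fun z hz => isQuasiFlat_clauseSat
    (y := (.conj y.1 z.1, y.2 ++ z.2)) ⟨⟨(hL y hy).1, (hM z hz).1⟩,
      List.forall_mem_append.2 ⟨(hL y hy).2, (hM z hz).2⟩⟩ :
    IsQuasiFlat fun T => ∃ y ∈ L, ∃ z ∈ M, _).congr fun T => ?_
  simp only [hLP, hMQ, clauseSat, traceSat, List.forall_mem_append, forall₂_and]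
  grind

theorem isQuasiFlat_exists {p : AP} {β : Formula AP} (h : β.isLTL) :
    IsQuasiFlat fun T => ∃ t ∈ T, traceSat β t :=
  (isQuasiFlat_clauseSat (y := (.disj (.atom p) (.natom p), [β]))
    ⟨⟨trivial, trivial⟩, by simpa using h⟩).congr fun T => by simp [clauseSat, traceSat, em]

theorem isQuasiFlat_true (p : AP) : IsQuasiFlat fun _ : Team AP => True :=
  (isQuasiFlat_flat (α := .disj (.atom p) (.natom p)) ⟨trivial, trivial⟩).congr
    fun T => by simp [traceSat, em]

theorem IsQuasiFlat.forall_mem (p : AP) {ι : Type*} {Q : ι → Team AP → Prop} {L : List ι}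
    (h : ∀ y ∈ L, IsQuasiFlat (Q y)) : IsQuasiFlat fun T => ∀ y ∈ L, Q y T := by
  induction L with
  | nil => exact (isQuasiFlat_true p).congr fun T => by simp
  | cons y L ih =>
    obtain ⟨h₁, h₂⟩ := List.forall_mem_cons.1 h
    exact (h₁.and (ih h₂)).congr fun T => by simp

theorem IsQuasiFlat.not (p : AP) {P : Team AP → Prop} (hP : IsQuasiFlat P) :
    IsQuasiFlat fun T => ¬ P T := by
  obtain ⟨L, hL, hLP⟩ := hP
  refine (forall_mem p fun y hy => (isQuasiFlat_exists (p := p) (hL y hy).1.dual).or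
    (exists_mem fun β hβ => isQuasiFlat_flat ((hL y hy).2 β hβ).dual) :
    IsQuasiFlat fun T => ∀ y ∈ L, _).congr fun T => ?_
  rw [hLP]
  push Not
  refine forall₂_congr fun y hy => ?_
  have hβ : (∃ β ∈ y.2, ∀ t ∈ T, traceSat β.dual t) ↔ ∃ β ∈ y.2, ∀ t ∈ T, ¬ traceSat β t :=
    exists_congr fun β => and_congr_right fun hβ =>
      forall₂_congr fun t _ => traceSat_dual ((hL y hy).2 β hβ) t
  simp only [hβ, traceSat_dual (hL y hy).1, clauseSat, not_and_or]
  push Not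
  rfl

theorem isQuasiFlat_laxSat {φ : Formula AP} (h : φ.leftDC) : IsQuasiFlat (laxSat φ) := by
  induction φ with
  | atom p => exact isQuasiFlat_flat (α := .atom p) trivial
  | natom p => exact isQuasiFlat_flat (α := .natom p) trivial
  | conj φ ψ ih₁ ih₂ => exact (ih₁ h.1).and (ih₂ h.2)
  | disj φ ψ ih₁ ih₂ =>
    obtain ⟨L, hL, hLP⟩ := ih₁ h.1
    obtain ⟨M, hM, hMP⟩ := ih₂ h.2
    refine (IsQuasiFlat.exists_mem fun y hy => .exists_mem fun z hz => isQuasiFlat_clauseSat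
      (y := (.disj y.1 z.1, y.2.map (.conj y.1) ++ z.2.map (.conj z.1)))
      ⟨⟨(hL y hy).1, (hM z hz).1⟩, List.forall_mem_append.2
        ⟨(List.forall_mem_map (f := Formula.conj y.1)).2
            fun β hβ => ⟨(hL y hy).1, (hL y hy).2 β hβ⟩,
          (List.forall_mem_map (f := Formula.conj z.1)).2
            fun β hβ => ⟨(hM z hz).1, (hM z hz).2 β hβ⟩⟩⟩ :
      IsQuasiFlat fun T => ∃ y ∈ L, ∃ z ∈ M, _).congr fun T => ?_
    simp only [laxSat, hLP, hMP, ← disj_clause_iff]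
    grind
  | next φ ih =>
    obtain ⟨L, hL, hLP⟩ := ih h
    refine (IsQuasiFlat.exists_mem fun y hy => isQuasiFlat_clauseSat
      (y := (.next y.1, y.2.map .next))
      ⟨(hL y hy).1, List.forall_mem_map.2 (hL y hy).2⟩ :
      IsQuasiFlat fun T => ∃ y ∈ L, _).congr fun T => ?_
    simp [laxSat, hLP, clauseSat, traceSat, forall_mem_update, exists_mem_update]
  | glob φ ih =>
    obtain ⟨L, hL, hLP⟩ := isFlatDisj_laxSat (φ := φ) h
    refine (IsQuasiFlat.exists_mem fun α hα => isQuasiFlat_flat (α := .glob α) (hL α hα) :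
      IsQuasiFlat fun T => ∃ α ∈ L, _).congr fun T => ?_
    simp only [laxSat, hLP, glob_flat_iff]
  | untl φ ψ ih₁ ih₂ =>
    obtain ⟨L, hL, hLP⟩ := isFlatDisj_laxSat h.1
    obtain ⟨M, hM, hMP⟩ := ih₂ h.2
    refine (IsQuasiFlat.exists_mem fun α hα => .exists_mem fun z hz => isQuasiFlat_clauseSat
      (y := (.untl α z.1, z.2.map fun γ => .untl α (.conj z.1 γ)))
      ⟨⟨hL α hα, (hM z hz).1⟩, List.forall_mem_map.2
        fun γ hγ => ⟨hL α hα, (hM z hz).1, (hM z hz).2 γ hγ⟩⟩ :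
      IsQuasiFlat fun T => ∃ α ∈ L, ∃ z ∈ M, _).congr fun T => ?_
    rw [laxSat_untl_iff hLP (laxSat_empty h.1)]
    simp only [hMP, ← untl_clause_iff]
    grind
  | bor φ ψ ih₁ ih₂ => exact (ih₁ h.1).or (ih₂ h.2)
  | bneg φ ih => exact (ih h).not φ.someAtom

theorem laxSat_exi {β : Formula AP} (h : β.isLTL) (T : Team AP) :
    laxSat β.exi T ↔ ∃ t ∈ T, traceSat β t := by
  simp [Formula.exi, laxSat, laxSat_iff_of_isLTL h.dual, traceSat_dual h]

theorem laxSat_conjAnd (α : Formula AP) (l : List (Formula AP)) (T : Team AP) :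
    laxSat (conjAnd α l) T ↔ laxSat α T ∧ ∀ β ∈ l, laxSat β T := by
  induction l with
  | nil => simp [conjAnd]
  | cons b l ih =>
    simp only [conjAnd, laxSat, ih, List.forall_mem_cons]
    tauto

theorem laxSat_disjOf (α : Formula AP) (l : List (Formula AP)) (T : Team AP) :
    laxSat (disjOf α l) T ↔ ∃ β ∈ α :: l, laxSat β T := by
  induction l generalizing α with
  | nil => simp [disjOf]
  | cons b l ih => simp [disjOf, laxSat, ih]

theorem laxSat_clause {y : Formula AP × List (Formula AP)} (h : clauseLTL y) (T : Team AP) :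
    laxSat (conjAnd y.1 (y.2.map Formula.exi)) T ↔ clauseSat y T := by
  rw [laxSat_conjAnd, laxSat_iff_of_isLTL h.1, List.forall_mem_map]
  exact and_congr_right' (forall₂_congr fun β hβ => laxSat_exi (h.2 β hβ) T)

/-- **Quasi-flat normal form**: every left-downward closed TeamLTL(∼,⊽)-formula is
equivalent under lax team semantics to a formula `⊽_{i∈I} (αᵢ ∧ ⋀_{j∈Jᵢ} ∃βᵢⱼ)`,
where the `αᵢ` and `βᵢⱼ` are LTL-formulae and `∃β` abbreviates `∼β^d`. -/
theorem quasi_flat_normal_form {AP : Type} (φ : Formula AP) (hφ : φ.leftDC) :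
    ∃ (x : Formula AP × List (Formula AP))
      (xs : List (Formula AP × List (Formula AP))),
      (∀ y ∈ x :: xs, y.1.isLTL ∧ ∀ β ∈ y.2, β.isLTL) ∧
      ∀ T : Team AP, laxSat φ T ↔
        laxSat (disjOf (conjAnd x.1 (x.2.map Formula.exi))
          (xs.map fun y => conjAnd y.1 (y.2.map Formula.exi))) T := by
  obtain ⟨L, hL, hLP⟩ := isQuasiFlat_laxSat hφ
  let p := φ.someAtom
  let bot : Formula AP × List (Formula AP) := (.atom p, [.conj (.atom p) (.natom p)])
  have hbot : clauseLTL bot := ⟨trivial, by simp [bot, Formula.isLTL]⟩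
  have hall := List.forall_mem_cons.2 ⟨hbot, hL⟩
  refine ⟨bot, L, hall, fun T => ?_⟩
  have hbotT : ¬ clauseSat bot T := by simp [bot, clauseSat, traceSat]
  rw [hLP, laxSat_disjOf,
    ← List.map_cons (f := fun y : Formula AP × List (Formula AP) =>
      conjAnd y.1 (y.2.map Formula.exi))]
  simp only [List.mem_map, exists_exists_and_eq_and]
  rw [exists_congr fun y => and_congr_right fun hy => laxSat_clause (hall y hy) T]
  simp [hbotT]

end TeamLTL
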